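/- The N² matrices J_{ab} = β^a γ^{-b}, indexed by pairs (a,b) with 0 ≤ a, b ≤ N−1, form a ℂ-basis of the space of all N×N complex matrices. -/

import Mathlib

/-- `epsN N = exp(2*pi*i/N)`. -/
noncomputable def epsN (N : ℕ) : ℂ := Complex.exp (2 * Real.pi * Complex.I / N)

/-- The cyclic shift matrix `beta` with entry `1` at `(i, j)` iff `j = i + 1 (mod N)`. -/
def betaM (N : ℕ) [NeZero N] : Matrix (Fin N) (Fin N) ℂ :=
  fun i j => if j = i + 1 then 1 else 0

/-- The diagonal matrix `gamma = diag(1, eps^(-1), ..., eps^(1-N))`. -/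
noncomputable def gammaM (N : ℕ) : Matrix (Fin N) (Fin N) ℂ :=
  Matrix.diagonal fun i => epsN N ^ (-(i.val : ℤ))

theorem epsN_isPrimitiveRoot (N : ℕ) [NeZero N] : IsPrimitiveRoot (epsN N) N :=
  Complex.isPrimitiveRoot_exp N (NeZero.ne N)

theorem betaM_pow_apply (N : ℕ) [NeZero N] (a : ℕ) (i j : Fin N) :
    (betaM N ^ a) i j = if j.val = (i.val + a) % N then 1 else 0 := by
  induction a generalizing i with
  | zero => simp [Matrix.one_apply, Nat.mod_eq_of_lt i.isLt, Fin.ext_iff, eq_comm]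
  | succ a ih =>
    rw [pow_succ', Matrix.mul_apply]
    simp only [betaM, ite_mul, one_mul, zero_mul, Finset.sum_ite_eq', Finset.mem_univ, if_true]
    rw [ih]
    have h : ((i + 1 : Fin N).val + a) % N = (i.val + (a + 1)) % N := by
      rw [Fin.val_add, Fin.val_one', Nat.add_mod_mod, Nat.mod_add_mod]
      congr 1
      ring
    rw [h]

theorem gammaM_pow_inv (N : ℕ) [NeZero N] (b : ℕ) :
    (gammaM N ^ b)⁻¹ = Matrix.diagonal fun i => (epsN N ^ i.val) ^ b := by
  have hε : epsN N ≠ 0 := Complex.exp_ne_zero _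
  apply Matrix.inv_eq_left_inv
  rw [gammaM, Matrix.diagonal_pow, Matrix.diagonal_mul_diagonal, ← Matrix.diagonal_one]
  congr 1
  funext i
  simp [hε]

theorem J_apply (N : ℕ) [NeZero N] (a b : Fin N) (i j : Fin N) :
    (betaM N ^ (a : ℕ) * (gammaM N ^ (b : ℕ))⁻¹) i j =
      if j = i + a then (epsN N ^ j.val) ^ b.val else 0 := by
  rw [gammaM_pow_inv, Matrix.mul_diagonal, betaM_pow_apply]
  simp [Fin.ext_iff, Fin.val_add]

theorem linearIndependent_J (N : ℕ) [NeZero N] :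
    LinearIndependent ℂ (fun p : Fin N × Fin N =>
      betaM N ^ (p.1 : ℕ) * (gammaM N ^ (p.2 : ℕ))⁻¹) := by
  rw [Fintype.linearIndependent_iff]
  rintro c hc ⟨a, b⟩
  have hinj : Function.Injective fun j : Fin N => epsN N ^ j.val := fun j k h =>
    Fin.ext ((epsN_isPrimitiveRoot N).pow_inj j.isLt k.isLt h)
  refine congrFun (Matrix.eq_zero_of_forall_index_sum_pow_mul_eq_zero
    (v := fun b => c (a, b)) hinj fun j => ?_) b
  have h := congrFun (congrFun hc (j - a)) j
  have hiff (x : Fin N) : j = j - a + x ↔ x = a := by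
    rw [← sub_eq_iff_eq_add', sub_sub_cancel, eq_comm]
  simpa [Matrix.sum_apply, J_apply, Fintype.sum_prod_type_right, hiff, mul_comm] using h

/-- The `N^2` matrices `J_ab = beta^a * gamma^(-b)` for `0 <= a, b <= N-1` form a
`C`-basis of the space of all `N x N` complex matrices: they are linearly
independent and span the whole space. -/
theorem J_forms_basis (N : ℕ) [NeZero N] (hN : 2 ≤ N) :
    LinearIndependent ℂ (fun p : Fin N × Fin N =>
      betaM N ^ (p.1 : ℕ) * (gammaM N ^ (p.2 : ℕ))⁻¹) ∧
    Submodule.span ℂ (Set.range (fun p : Fin N × Fin N =>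
      betaM N ^ (p.1 : ℕ) * (gammaM N ^ (p.2 : ℕ))⁻¹)) = ⊤ := by
  refine ⟨linearIndependent_J N, (linearIndependent_J N).span_eq_top_of_card_eq_finrank' ?_⟩
  simp [Module.finrank_matrix]
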